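/- Let S be a semigroup and let R be an S-graded ring. Then R is graded von Neumann regular if and only if R is nearly epsilon-strongly S-graded and R_e is a von Neumann regular ring for every e ∈ E(S). -/

import Mathlib

open scoped Pointwise

/-- The set `E(S)` of idempotent elements of a semigroup `S`. -/
def idempotentSet (S : Type*) [Semigroup S] : Set S := {s | s * s = s}

/-- The set `V(s) = {t ∈ S ∣ sts = s and tst = t}`. -/
def invSet {S : Type*} [Semigroup S] (s : S) : Set S :=
  {t | s * t * s = s ∧ t * s * t = t}

/-- The product `A B` of two additive subgroups of a ring: the additive subgroup
generated by all products `a * b` with `a ∈ A`, `b ∈ B`. -/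
def subgroupMul {R : Type*} [NonUnitalRing R] (A B : AddSubgroup R) : AddSubgroup R :=
  AddSubgroup.closure ((A : Set R) * (B : Set R))

/-- `R` is an `S`-graded ring via the family `𝒜` of additive subgroups:
`R = ⊕_{s ∈ S} R_s` (internal direct sum) and `R_s R_t ⊆ R_{st}`. -/
structure IsSemigroupGrading {S R : Type*} [Semigroup S] [DecidableEq S] [NonUnitalRing R]
    (𝒜 : S → AddSubgroup R) : Prop where
  internal : DirectSum.IsInternal 𝒜
  mul_mem : ∀ s t : S, ∀ a ∈ 𝒜 s, ∀ b ∈ 𝒜 t, a * b ∈ 𝒜 (s * t)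

/-- `R` is symmetrically `S`-graded: `R_s = R_s R_t R_s` for all `s ∈ S`, `t ∈ V(s)`. -/
def SymmetricallyGraded {S R : Type*} [Semigroup S] [NonUnitalRing R]
    (𝒜 : S → AddSubgroup R) : Prop :=
  ∀ s : S, ∀ t ∈ invSet s, 𝒜 s = subgroupMul (subgroupMul (𝒜 s) (𝒜 t)) (𝒜 s)

/-- A subset `P` of `R` (closed under multiplication) is a unital ring:
it has a two-sided multiplicative identity element. -/
def HasUnity {R : Type*} [NonUnitalRing R] (P : AddSubgroup R) : Prop :=
  ∃ u ∈ P, ∀ x ∈ P, u * x = x ∧ x * u = x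

/-- A subset `P` of `R` is an s-unital ring: `x ∈ Px` and `x ∈ xP` for every `x ∈ P`. -/
def IsSUnital {R : Type*} [NonUnitalRing R] (P : AddSubgroup R) : Prop :=
  ∀ x ∈ P, (∃ u ∈ P, u * x = x) ∧ (∃ v ∈ P, x * v = x)

/-- A subset `P` of `R` is a von Neumann regular ring: `r ∈ rPr` for every `r ∈ P`. -/
def IsVonNeumannRegular {R : Type*} [NonUnitalRing R] (P : AddSubgroup R) : Prop :=
  ∀ r ∈ P, ∃ x ∈ P, r = r * x * r

/-- `R` is epsilon-strongly `S`-graded. -/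
def EpsilonStronglyGraded {S R : Type*} [Semigroup S] [NonUnitalRing R]
    (𝒜 : S → AddSubgroup R) : Prop :=
  SymmetricallyGraded 𝒜 ∧ ∀ s : S, ∀ t ∈ invSet s, HasUnity (subgroupMul (𝒜 s) (𝒜 t))

/-- `R` is nearly epsilon-strongly `S`-graded. -/
def NearlyEpsilonStronglyGraded {S R : Type*} [Semigroup S] [NonUnitalRing R]
    (𝒜 : S → AddSubgroup R) : Prop :=
  SymmetricallyGraded 𝒜 ∧ ∀ s : S, ∀ t ∈ invSet s, IsSUnital (subgroupMul (𝒜 s) (𝒜 t))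

/-- `R` is strongly `S`-graded: `R_s R_t = R_{st}` for all `s, t ∈ S`. -/
def StronglyGraded {S R : Type*} [Semigroup S] [NonUnitalRing R]
    (𝒜 : S → AddSubgroup R) : Prop :=
  ∀ s t : S, subgroupMul (𝒜 s) (𝒜 t) = 𝒜 (s * t)

/-- `R` is graded von Neumann regular: for all `s ∈ S`, `r ∈ R_s` and `t ∈ V(s)`,
there is `y ∈ R_t` with `r = ryr`. -/
def GradedVonNeumannRegular {S R : Type*} [Semigroup S] [NonUnitalRing R]
    (𝒜 : S → AddSubgroup R) : Prop :=
  ∀ s : S, ∀ r ∈ 𝒜 s, ∀ t ∈ invSet s, ∃ y ∈ 𝒜 t, r = r * y * r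

section SubgroupMul

variable {R : Type*} [NonUnitalRing R]

theorem mul_mem_subgroupMul {A B : AddSubgroup R} {a b : R} (ha : a ∈ A) (hb : b ∈ B) :
    a * b ∈ subgroupMul A B :=
  AddSubgroup.subset_closure (Set.mul_mem_mul ha hb)

theorem subgroupMul_le {A B C : AddSubgroup R} :
    subgroupMul A B ≤ C ↔ ∀ a ∈ A, ∀ b ∈ B, a * b ∈ C := by
  rw [subgroupMul, AddSubgroup.closure_le, Set.mul_subset_iff]
  rfl

/-- `x * y ∈ D` for all `x ∈ A B` as soon as this holds for products `x = a * b`. -/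
theorem mul_right_mem_of_mem_subgroupMul {A B D : AddSubgroup R} {x y : R}
    (hx : x ∈ subgroupMul A B) (h : ∀ a ∈ A, ∀ b ∈ B, a * b * y ∈ D) : x * y ∈ D :=
  (subgroupMul_le (C := D.comap (AddMonoidHom.mulRight y))).2 h hx

/-- `y * x ∈ D` for all `x ∈ A B` as soon as this holds for products `x = a * b`. -/
theorem mul_left_mem_of_mem_subgroupMul {A B D : AddSubgroup R} {x y : R}
    (hx : x ∈ subgroupMul A B) (h : ∀ a ∈ A, ∀ b ∈ B, y * (a * b) ∈ D) : y * x ∈ D :=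
  (subgroupMul_le (C := D.comap (AddMonoidHom.mulLeft y))).2 h hx

theorem subgroupMul_assoc (A B C : AddSubgroup R) :
    subgroupMul (subgroupMul A B) C = subgroupMul A (subgroupMul B C) := by
  apply le_antisymm
  · refine subgroupMul_le.2 fun x hx c hc => mul_right_mem_of_mem_subgroupMul hx
      fun a ha b hb => ?_
    rw [mul_assoc]
    exact mul_mem_subgroupMul ha (mul_mem_subgroupMul hb hc)
  · refine subgroupMul_le.2 fun a ha x hx => mul_left_mem_of_mem_subgroupMul hx
      fun b hb c hc => ?_
    rw [← mul_assoc]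
    exact mul_mem_subgroupMul (mul_mem_subgroupMul ha hb) hc

/-- Elements of `A T` have a right unit in `T` when `T` is an s-unital ring. -/
theorem IsSUnital.exists_mul_eq_self {A T : AddSubgroup R} (hT : IsSUnital T)
    (hmul : ∀ x ∈ T, ∀ y ∈ T, x * y ∈ T) {r : R} (hr : r ∈ subgroupMul A T) :
    ∃ v ∈ T, r * v = r := by
  suffices h : ∀ v₀ ∈ T, ∃ v ∈ T, (∀ x, x * v₀ = x → x * v = x) ∧ r * v = r by
    obtain ⟨v, hv, -, hrv⟩ := h 0 T.zero_mem
    exact ⟨v, hv, hrv⟩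
  induction hr using AddSubgroup.closure_induction with
  | mem r hr =>
    obtain ⟨a, -, x, hx, rfl⟩ := hr
    intro v₀ hv₀
    obtain ⟨-, u, hu, hxu⟩ := hT _ (T.sub_mem hx (hmul x hx v₀ hv₀))
    refine ⟨v₀ + u - v₀ * u, T.sub_mem (T.add_mem hv₀ hu) (hmul _ hv₀ _ hu), fun z hz => ?_, ?_⟩
    · rw [mul_sub, mul_add, ← mul_assoc, hz, add_sub_cancel_right]
    · have hx' : x * (v₀ + u - v₀ * u) = x * v₀ + (x - x * v₀) * u := by noncomm_ring
      change a * x * _ = a * x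
      rw [mul_assoc, hx', hxu, add_sub_cancel]
  | zero => exact fun v₀ hv₀ => ⟨v₀, hv₀, fun _ => id, zero_mul _⟩
  | add x y _ _ ihx ihy =>
    intro v₀ hv₀
    obtain ⟨v₁, hv₁, h₁, hx⟩ := ihx v₀ hv₀
    obtain ⟨v₂, hv₂, h₂, hy⟩ := ihy v₁ hv₁
    exact ⟨v₂, hv₂, fun z hz => h₂ z (h₁ z hz), by rw [add_mul, h₂ x hx, hy]⟩
  | neg x _ ih =>
    intro v₀ hv₀
    obtain ⟨v, hv, h, hx⟩ := ih v₀ hv₀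
    exact ⟨v, hv, h, by rw [neg_mul, hx]⟩

/-- If `r B` lies in a von Neumann regular ring `P` acting on `B` from the right, then each
element of `r B C` is fixed by left multiplication by some element of `r B`. -/
theorem IsVonNeumannRegular.exists_mul_mul_eq {P B C : AddSubgroup R}
    (hP : IsVonNeumannRegular P) {r : R} (hrB : ∀ b ∈ B, r * b ∈ P)
    (hBP : ∀ b ∈ B, ∀ p ∈ P, b * p ∈ B) {v : R} (hv : v ∈ subgroupMul B C) :
    ∃ y ∈ B, r * y * (r * v) = r * v := by
  suffices h : ∀ y₀ ∈ B, ∃ y ∈ B, (∀ x, r * y₀ * x = x → r * y * x = x) ∧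
      r * y * (r * v) = r * v by
    obtain ⟨y, hy, -, hyv⟩ := h 0 B.zero_mem
    exact ⟨y, hy, hyv⟩
  induction hv using AddSubgroup.closure_induction with
  | mem v hv =>
    obtain ⟨b, hb, c, -, rfl⟩ := hv
    intro y₀ hy₀
    have hd : b - y₀ * (r * b) ∈ B := B.sub_mem hb (hBP _ hy₀ _ (hrB b hb))
    obtain ⟨w, hw, hz⟩ := hP _ (hrB _ hd)
    have hdw := hBP _ hd _ hw
    refine ⟨y₀ + (b - y₀ * (r * b)) * w - (b - y₀ * (r * b)) * w * (r * y₀),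
      B.sub_mem (B.add_mem hy₀ hdw) (hBP _ hdw _ (hrB _ hy₀)), fun x hx => ?_, ?_⟩
    · calc _ = r * y₀ * x + r * (b - y₀ * (r * b)) * w * (x - r * y₀ * x) := by noncomm_ring
        _ = x := by rw [hx, sub_self, mul_zero, add_zero]
    · calc _ = (r * y₀ * (r * b) +
              r * (b - y₀ * (r * b)) * w * (r * (b - y₀ * (r * b)))) * c := by noncomm_ring
        _ = r * (b * c) := by rw [← hz]; noncomm_ring
  | zero => exact fun y₀ hy₀ => ⟨y₀, hy₀, fun _ => id, by simp⟩
  | add x y _ _ ihx ihy =>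
    intro y₀ hy₀
    obtain ⟨y₁, hy₁, h₁, hx⟩ := ihx y₀ hy₀
    obtain ⟨y₂, hy₂, h₂, hy⟩ := ihy y₁ hy₁
    exact ⟨y₂, hy₂, fun z hz => h₂ z (h₁ z hz), by rw [mul_add r x, mul_add, h₂ _ hx, hy]⟩
  | neg x _ ih =>
    intro y₀ hy₀
    obtain ⟨y, hy, h, hx⟩ := ih y₀ hy₀
    exact ⟨y, hy, h, by rw [mul_neg r x, mul_neg, hx]⟩

end SubgroupMul

section Graded

variable {S R : Type*} [Semigroup S] [NonUnitalRing R] {𝒜 : S → AddSubgroup R}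

theorem GradedVonNeumannRegular.isVonNeumannRegular (h : GradedVonNeumannRegular 𝒜) {e : S}
    (he : e ∈ idempotentSet S) : IsVonNeumannRegular (𝒜 e) := by
  have he' : e * e = e := he
  exact fun r hr => h e r hr e ⟨by rw [he', he'], by rw [he', he']⟩

theorem GradedVonNeumannRegular.symmetricallyGraded (h : GradedVonNeumannRegular 𝒜)
    (hmul : ∀ s t : S, ∀ a ∈ 𝒜 s, ∀ b ∈ 𝒜 t, a * b ∈ 𝒜 (s * t)) :
    SymmetricallyGraded 𝒜 := by
  intro s t ht
  apply le_antisymm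
  · intro r hr
    obtain ⟨y, hy, hryr⟩ := h s r hr t ht
    rw [hryr]
    exact mul_mem_subgroupMul (mul_mem_subgroupMul hr hy) hr
  · refine subgroupMul_le.2 fun x hx c hc => ?_
    have := hmul _ _ x (subgroupMul_le.2 (hmul s t) hx) c hc
    rwa [ht.1] at this

theorem GradedVonNeumannRegular.isSUnital (h : GradedVonNeumannRegular 𝒜)
    (hmul : ∀ s t : S, ∀ a ∈ 𝒜 s, ∀ b ∈ 𝒜 t, a * b ∈ 𝒜 (s * t))
    {s t : S} (ht : t ∈ invSet s) : IsSUnital (subgroupMul (𝒜 s) (𝒜 t)) := by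
  intro x hx
  have he : s * t * (s * t) = s * t := by rw [← mul_assoc, ht.1]
  obtain ⟨y, hy, hxyx⟩ := h.isVonNeumannRegular he x (subgroupMul_le.2 (hmul s t) hx)
  refine ⟨⟨x * y, ?_, hxyx.symm⟩, y * x, ?_, by rw [← mul_assoc, ← hxyx]⟩
  · refine mul_right_mem_of_mem_subgroupMul hx fun a ha b hb => ?_
    have := hmul _ _ b hb y hy
    rw [← mul_assoc, ht.2] at this
    rw [mul_assoc]
    exact mul_mem_subgroupMul ha this
  · refine mul_left_mem_of_mem_subgroupMul hx fun a ha b hb => ?_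
    have := hmul _ _ y hy a ha
    rw [ht.1] at this
    rw [← mul_assoc]
    exact mul_mem_subgroupMul this hb

theorem NearlyEpsilonStronglyGraded.gradedVonNeumannRegular (h : NearlyEpsilonStronglyGraded 𝒜)
    (hmul : ∀ s t : S, ∀ a ∈ 𝒜 s, ∀ b ∈ 𝒜 t, a * b ∈ 𝒜 (s * t))
    (hreg : ∀ e ∈ idempotentSet S, IsVonNeumannRegular (𝒜 e)) : GradedVonNeumannRegular 𝒜 := by
  intro s r hr t ht
  have hr' := hr
  rw [h.1 s t ht, subgroupMul_assoc] at hr'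
  have hT : ∀ x ∈ subgroupMul (𝒜 t) (𝒜 s), ∀ y ∈ subgroupMul (𝒜 t) (𝒜 s),
      x * y ∈ subgroupMul (𝒜 t) (𝒜 s) := by
    refine fun x hx y hy => mul_left_mem_of_mem_subgroupMul hy fun a ha b hb => ?_
    have := hmul _ _ x (subgroupMul_le.2 (hmul t s) hx) a ha
    rw [ht.2] at this
    rw [← mul_assoc]
    exact mul_mem_subgroupMul this hb
  obtain ⟨v, hv, hrv⟩ := (h.2 t s ht.symm).exists_mul_eq_self hT hr'
  have he : s * t * (s * t) = s * t := by rw [← mul_assoc, ht.1]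
  have hBP : ∀ b ∈ 𝒜 t, ∀ p ∈ 𝒜 (s * t), b * p ∈ 𝒜 t := by
    intro b hb p hp
    have := hmul _ _ b hb p hp
    rwa [← mul_assoc, ht.2] at this
  obtain ⟨y, hy, hyv⟩ := (hreg _ he).exists_mul_mul_eq (fun b hb => hmul s t r hr b hb) hBP hv
  rw [hrv] at hyv
  exact ⟨y, hy, hyv.symm⟩

end Graded

/-- **Main Theorem.** Let `S` be a semigroup and `R` an `S`-graded ring. Then `R` is
graded von Neumann regular if and only if `R` is nearly epsilon-strongly `S`-graded and
`R_e` is von Neumann regular for every `e ∈ E(S)`. -/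
theorem gradedVonNeumannRegular_iff
    {S R : Type*} [Semigroup S] [DecidableEq S] [NonUnitalRing R]
    (𝒜 : S → AddSubgroup R) (hgr : IsSemigroupGrading 𝒜) :
    GradedVonNeumannRegular 𝒜 ↔
      NearlyEpsilonStronglyGraded 𝒜 ∧ ∀ e ∈ idempotentSet S, IsVonNeumannRegular (𝒜 e) := by
  exact ⟨fun h => ⟨⟨h.symmetricallyGraded hgr.mul_mem, fun _ _ ht => h.isSUnital hgr.mul_mem ht⟩,
      fun _ he => h.isVonNeumannRegular he⟩,
    fun h => h.1.gradedVonNeumannRegular hgr.mul_mem h.2⟩
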